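/- Let γ ∈ ℝ, let z₁, z₂, z₁', z₂', w ∈ ℝ², and let u ∈ ℝ² be a unit vector such that ⟨∇φ_γ(z₂') - ∇φ_γ(z₁'), u⟩ = 0 and ∇φ_γ(z₂') ≠ ∇φ_γ(z₁'). Then |det M| = |Γ^γ_w(z₁,z₂,z₁',z₂')| / |∇φ_γ(z₂') - ∇φ_γ(z₁')|, where M is the 3×3 matrix whose columns are N_γ(z₁), N_γ(z₂), and (Hφ_γ(w)·u, 0) ∈ ℝ³. -/

import Mathlib

open Matrix

noncomputable section

/-- The gradient `∇φ_γ(x,y) = (y, x + γy²)` of `φ_γ(x,y) = xy + (γ/3)y³`. -/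
def gradPhi (γ : ℝ) (z : ℝ × ℝ) : Fin 2 → ℝ :=
  ![z.2, z.1 + γ * z.2 ^ 2]

/-- The gradient as a vector of Euclidean space `ℝ²` (for its Euclidean length). -/
def gradPhiE (γ : ℝ) (z : ℝ × ℝ) : EuclideanSpace ℝ (Fin 2) :=
  (WithLp.equiv 2 (Fin 2 → ℝ)).symm (gradPhi γ z)

/-- The Hessian `Hφ_γ(x,y) = [[0,1],[1,2γy]]`. -/
def hessPhi (γ : ℝ) (z : ℝ × ℝ) : Matrix (Fin 2) (Fin 2) ℝ :=
  !![0, 1; 1, 2 * γ * z.2]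

/-- The normal `N_γ(z) = (∇φ_γ(z), -1)` to the graph of `φ_γ`. -/
def normalPhi (γ : ℝ) (z : ℝ × ℝ) : Fin 3 → ℝ :=
  ![z.2, z.1 + γ * z.2 ^ 2, -1]

/-- The four-point transversality quantity
`Γ^γ_w(z₁,z₂,z₁',z₂') = ⟨(Hφ_γ(w))⁻¹(∇φ_γ(z₂) - ∇φ_γ(z₁)), ∇φ_γ(z₂') - ∇φ_γ(z₁')⟩`. -/
def GammaFour (γ : ℝ) (w z₁ z₂ z₁' z₂' : ℝ × ℝ) : ℝ :=
  ((hessPhi γ w)⁻¹ *ᵥ (gradPhi γ z₂ - gradPhi γ z₁)) ⬝ᵥ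
    (gradPhi γ z₂' - gradPhi γ z₁')

theorem hessPhi_inv (γ : ℝ) (w : ℝ × ℝ) :
    (hessPhi γ w)⁻¹ = !![-(2 * γ * w.2), 1; 1, 0] := by
  apply Matrix.inv_eq_right_inv
  ext i j
  fin_cases i <;> fin_cases j <;> simp [hessPhi, Matrix.mul_apply, Fin.sum_univ_two]

/-- A plane vector orthogonal to a unit vector `u` is a multiple of the rotation of `u`. -/
theorem eq_mul_rotation_of_orthogonal {u₀ u₁ p q : ℝ} (hu : u₀ ^ 2 + u₁ ^ 2 = 1)
    (h : p * u₀ + q * u₁ = 0) :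
    p = (p * u₁ - q * u₀) * u₁ ∧ q = -((p * u₁ - q * u₀) * u₀) :=
  ⟨by linear_combination u₀ * h - p * hu, by linear_combination u₁ * h - q * hu⟩

theorem norm_gradPhiE_sub (γ : ℝ) (z z' : ℝ × ℝ) :
    ‖gradPhiE γ z - gradPhiE γ z'‖ =
      √((gradPhi γ z 0 - gradPhi γ z' 0) ^ 2 + (gradPhi γ z 1 - gradPhi γ z' 1) ^ 2) := by
  simp [EuclideanSpace.norm_eq, Fin.sum_univ_two, gradPhiE]

/-- The determinant identity behind the bilinear tangential estimate: if `u` is a unit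
vector of `ℝ²` orthogonal to `∇φ_γ(z₂') - ∇φ_γ(z₁') ≠ 0`, and `M` is the `3×3` matrix with
columns `N_γ(z₁)`, `N_γ(z₂)` and `(Hφ_γ(w)·u, 0)`, then
`|det M| = |Γ^γ_w(z₁,z₂,z₁',z₂')| / |∇φ_γ(z₂') - ∇φ_γ(z₁')|`. -/
theorem det_identity_tangential
    (γ : ℝ) (z₁ z₂ z₁' z₂' w : ℝ × ℝ) (u : Fin 2 → ℝ)
    (hu : u 0 ^ 2 + u 1 ^ 2 = 1)
    (horth : (gradPhi γ z₂' - gradPhi γ z₁') ⬝ᵥ u = 0)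
    (hne : gradPhi γ z₂' ≠ gradPhi γ z₁') :
    |(((Matrix.of
        ![normalPhi γ z₁, normalPhi γ z₂,
          ![(hessPhi γ w *ᵥ u) 0, (hessPhi γ w *ᵥ u) 1, 0]])ᵀ).det)| =
      |GammaFour γ w z₁ z₂ z₁' z₂'| / ‖gradPhiE γ z₂' - gradPhiE γ z₁'‖ := by
  obtain ⟨c, hp, hq⟩ : ∃ c, gradPhi γ z₂' 0 - gradPhi γ z₁' 0 = c * u 1 ∧
      gradPhi γ z₂' 1 - gradPhi γ z₁' 1 = -(c * u 0) :=
    ⟨_, eq_mul_rotation_of_orthogonal hu (by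
      simpa [dotProduct, Fin.sum_univ_two] using horth)⟩
  have hc : c ≠ 0 := by
    rintro rfl
    apply hne
    ext i
    fin_cases i
    · simpa [sub_eq_zero] using hp
    · simpa [sub_eq_zero] using hq
  have hnorm : ‖gradPhiE γ z₂' - gradPhiE γ z₁'‖ = |c| := by
    rw [norm_gradPhiE_sub, hp, hq, ← Real.sqrt_sq_eq_abs]
    congr 1
    linear_combination c ^ 2 * hu
  rw [hnorm, eq_div_iff (abs_ne_zero.mpr hc), ← abs_mul]
  congr 1
  simp only [GammaFour, hessPhi_inv, dotProduct, Fin.sum_univ_two, Pi.sub_apply, hp, hq]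
  simp [Matrix.det_fin_three, hessPhi, normalPhi, gradPhi, Matrix.mulVec, dotProduct,
    Fin.sum_univ_two]
  ring

end
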